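/- Let 𝒢 be an n-player potential game with potential Φ whose maximum local variation is δΦ > 0, and let 0 < c < 1 be a constant. If β ≤ c/(n·δΦ), then the logit dynamics with inverse noise β satisfies: for every ε ∈ (0,1) and every integer t ≥ (n/(1−c))·(ln n + ln(1/ε)), ‖P^t(x,·) − π‖_TV ≤ ε for every starting profile x. In particular the mixing time is O(n log n). -/

import Mathlib

noncomputable section

open Finset

variable {n : ℕ} {S : Fin n → Type*} [∀ i, Fintype (S i)] [∀ i, DecidableEq (S i)]
  [∀ i, Nonempty (S i)]

/-- Logit update probability `σ_i(z ∣ x)` with inverse noise `β` for the game with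
utilities `u`. -/
def logitSigma (β : ℝ) (u : Fin n → (∀ i, S i) → ℝ) (i : Fin n) (z : S i)
    (x : ∀ i, S i) : ℝ :=
  Real.exp (β * u i (Function.update x i z)) /
    ∑ w : S i, Real.exp (β * u i (Function.update x i w))

/-- Transition matrix of the logit dynamics with inverse noise `β`:
`P x y = (1/n) · σ_i(y_i ∣ x)` if `x` and `y` differ exactly in coordinate `i`,
`P x x = (1/n) · ∑ i, σ_i(x_i ∣ x)`, and `P x y = 0` otherwise. -/
def logitP (β : ℝ) (u : Fin n → (∀ i, S i) → ℝ) :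
    Matrix (∀ i, S i) (∀ i, S i) ℝ := fun x y =>
  (1 / (n : ℝ)) *
    ∑ i, if y = Function.update x i (y i) then logitSigma β u i (y i) x else 0

/-- `Φ` is an (exact) potential for the game with utilities `u`. -/
def IsPotential (u : Fin n → (∀ i, S i) → ℝ) (Φ : (∀ i, S i) → ℝ) : Prop :=
  ∀ (i : Fin n) (a b : S i) (x : ∀ i, S i),
    u i (Function.update x i a) - u i (Function.update x i b) =
      Φ (Function.update x i b) - Φ (Function.update x i a)

/-- The Gibbs measure `π(x) = exp(−β·Φ(x))/Z`. -/
def gibbs (β : ℝ) (Φ : (∀ i, S i) → ℝ) (x : ∀ i, S i) : ℝ :=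
  Real.exp (-β * Φ x) / ∑ y : ∀ i, S i, Real.exp (-β * Φ y)

/-- Total variation distance `(1/2)·∑ z, |μ z − ν z|`. -/
def tvDist {α : Type*} [Fintype α] (μ ν : α → ℝ) : ℝ :=
  (1 / 2) * ∑ z, |μ z - ν z|

/-- Maximum global variation `ΔΦ = max Φ − min Φ`. -/
def maxVar (Φ : (∀ i, S i) → ℝ) : ℝ :=
  sSup {d : ℝ | ∃ x y : ∀ i, S i, d = Φ x - Φ y}

/-- Two profiles are adjacent if they differ in exactly one coordinate. -/
def Adjacent (x y : ∀ i, S i) : Prop :=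
  (Finset.univ.filter fun i => x i ≠ y i).card = 1

/-- Maximum local variation `δΦ`. -/
def localVar (Φ : (∀ i, S i) → ℝ) : ℝ :=
  sSup {d : ℝ | ∃ x y : ∀ i, S i, Adjacent x y ∧ d = Φ x - Φ y}

set_option linter.unusedSectionVars false

theorem logitSigma_eq_of_isPotential {u : Fin n → (∀ i, S i) → ℝ} {Φ : (∀ i, S i) → ℝ}
    (hpot : IsPotential u Φ) (β : ℝ) (i : Fin n) (z : S i) (x : ∀ i, S i) :
    logitSigma β u i z x = Real.exp (-β * Φ (Function.update x i z)) /
      ∑ w : S i, Real.exp (-β * Φ (Function.update x i w)) := by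
  have key : ∀ w : S i, Real.exp (β * u i (Function.update x i w)) =
      Real.exp (β * (u i (Function.update x i z) + Φ (Function.update x i z))) *
        Real.exp (-β * Φ (Function.update x i w)) := by
    intro w
    rw [← Real.exp_add]
    congr 1
    linear_combination β * hpot i w z x
  unfold logitSigma
  simp_rw [key]
  rw [← Finset.mul_sum, mul_div_mul_left _ _ (Real.exp_ne_zero _)]

theorem logitSigma_nonneg (β : ℝ) (u : Fin n → (∀ i, S i) → ℝ) (i : Fin n) (z : S i)
    (x : ∀ i, S i) : 0 ≤ logitSigma β u i z x := by
  unfold logitSigma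
  positivity

theorem sum_logitSigma (β : ℝ) (u : Fin n → (∀ i, S i) → ℝ) (i : Fin n)
    (x : ∀ i, S i) : ∑ z, logitSigma β u i z x = 1 := by
  unfold logitSigma
  rw [← Finset.sum_div]
  exact div_self (Finset.sum_pos (fun w _ => Real.exp_pos _) Finset.univ_nonempty).ne'

theorem logitSigma_update_self (β : ℝ) (u : Fin n → (∀ i, S i) → ℝ) (i : Fin n) (z a : S i)
    (x : ∀ i, S i) : logitSigma β u i z (Function.update x i a) = logitSigma β u i z x := by
  simp [logitSigma]

theorem logitP_mulVec (β : ℝ) (u : Fin n → (∀ i, S i) → ℝ) (f : (∀ i, S i) → ℝ)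
    (x : ∀ i, S i) :
    (logitP β u).mulVec f x = (1 / (n : ℝ)) *
      ∑ i, ∑ z, logitSigma β u i z x * f (Function.update x i z) := by
  simp only [Matrix.mulVec, dotProduct, logitP, mul_assoc, Finset.sum_mul]
  rw [← Finset.mul_sum, Finset.sum_comm]
  congr 1
  refine Finset.sum_congr rfl fun i _ => ?_
  simp only [ite_mul, zero_mul]
  rw [← Finset.sum_filter]
  refine Finset.sum_bij' (fun y _ => y i) (fun z _ => Function.update x i z) ?_ ?_ ?_ ?_ ?_
  · simp
  · simp
  · intro y hy
    exact (Finset.mem_filter.1 hy).2.symm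
  · simp
  · intro y hy
    rw [← (Finset.mem_filter.1 hy).2]

theorem gibbs_nonneg (β : ℝ) (Φ : (∀ i, S i) → ℝ) (x : ∀ i, S i) : 0 ≤ gibbs β Φ x := by
  unfold gibbs
  positivity

theorem sum_gibbs (β : ℝ) (Φ : (∀ i, S i) → ℝ) : ∑ x, gibbs β Φ x = 1 := by
  unfold gibbs
  rw [← Finset.sum_div]
  exact div_self (Finset.sum_pos (fun w _ => Real.exp_pos _) Finset.univ_nonempty).ne'

/-- Detailed balance of the logit dynamics with respect to the Gibbs measure. -/
theorem gibbs_mul_logitP {u : Fin n → (∀ i, S i) → ℝ} {Φ : (∀ i, S i) → ℝ}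
    (hpot : IsPotential u Φ) (β : ℝ) (x y : ∀ i, S i) :
    gibbs β Φ x * logitP β u x y = gibbs β Φ y * logitP β u y x := by
  simp only [logitP]
  rw [mul_left_comm, mul_left_comm (gibbs β Φ y), Finset.mul_sum _ _ (gibbs β Φ x),
    Finset.mul_sum _ _ (gibbs β Φ y)]
  congr 1
  refine Finset.sum_congr rfl fun i _ => ?_
  by_cases h : y = Function.update x i (y i)
  · have h' : x = Function.update y i (x i) := by rw [h]; simp
    have hw : ∀ w, Function.update y i w = Function.update x i w := by
      intro w
      rw [h, Function.update_idem]
    rw [if_pos h, if_pos h', logitSigma_eq_of_isPotential hpot, logitSigma_eq_of_isPotential hpot,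
      ← h, ← h']
    simp only [hw, gibbs]
    ring
  · have h' : ¬ x = Function.update y i (x i) := by
      intro h'
      apply h
      rw [h']
      simp
    rw [if_neg h, if_neg h', mul_zero, mul_zero]

theorem gibbs_vecMul_logitP (hn : 1 ≤ n) {u : Fin n → (∀ i, S i) → ℝ} {Φ : (∀ i, S i) → ℝ}
    (hpot : IsPotential u Φ) (β : ℝ) :
    Matrix.vecMul (gibbs β Φ) (logitP β u) = gibbs β Φ := by
  ext y
  have h1 := logitP_mulVec β u (fun _ => 1) y
  have hn' : (n : ℝ) ≠ 0 := by positivity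
  simp only [mul_one, sum_logitSigma, Finset.sum_const, Finset.card_univ, Fintype.card_fin,
    nsmul_eq_mul, one_div, inv_mul_cancel₀ hn', Matrix.mulVec, dotProduct] at h1
  simp only [Matrix.vecMul, dotProduct, gibbs_mul_logitP hpot β _ y]
  rw [← Finset.mul_sum, h1, mul_one]

theorem gibbs_vecMul_logitP_pow (hn : 1 ≤ n) {u : Fin n → (∀ i, S i) → ℝ}
    {Φ : (∀ i, S i) → ℝ} (hpot : IsPotential u Φ) (β : ℝ) (t : ℕ) :
    Matrix.vecMul (gibbs β Φ) (logitP β u ^ t) = gibbs β Φ := by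
  induction t with
  | zero => simp
  | succ t ih => rw [pow_succ, ← Matrix.vecMul_vecMul, ih, gibbs_vecMul_logitP hn hpot]

theorem abs_sub_update_le_localVar {Φ : (∀ i, S i) → ℝ} (hloc : 0 ≤ localVar Φ)
    (x : ∀ i, S i) (i : Fin n) (a : S i) :
    |Φ x - Φ (Function.update x i a)| ≤ localVar Φ := by
  have hbdd : BddAbove {d : ℝ | ∃ x y : ∀ i, S i, Adjacent x y ∧ d = Φ x - Φ y} := by
    refine (Set.Finite.subset (Set.finite_range
      fun p : (∀ i, S i) × (∀ i, S i) => Φ p.1 - Φ p.2) ?_).bddAbove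
    rintro d ⟨x, y, -, rfl⟩
    exact ⟨(x, y), rfl⟩
  by_cases h : x i = a
  · subst h
    simpa using hloc
  · have hadj : Adjacent x (Function.update x i a) := by
      unfold Adjacent
      rw [Finset.card_eq_one]
      refine ⟨i, ?_⟩
      ext j
      by_cases hj : j = i
      · subst hj
        simpa using h
      · simp [hj]
    have hadj' : Adjacent (Function.update x i a) x := by
      unfold Adjacent at *
      simpa only [ne_comm] using hadj
    rw [abs_le']
    refine ⟨le_csSup hbdd ⟨_, _, hadj, rfl⟩, ?_⟩
    rw [neg_sub]
    exact le_csSup hbdd ⟨_, _, hadj', rfl⟩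

/-- A function varying by at most `L` under single-coordinate updates varies by at most `n * L`. -/
theorem abs_sub_le_of_abs_sub_update_le {f : (∀ i, S i) → ℝ} {L : ℝ}
    (hf : ∀ x i a, |f x - f (Function.update x i a)| ≤ L) (x y : ∀ i, S i) :
    |f x - f y| ≤ n * L := by
  have key : ∀ s : Finset (Fin n), |f x - f (s.piecewise y x)| ≤ s.card * L := by
    intro s
    induction s using Finset.induction_on with
    | empty => simp
    | insert j s hj ih =>
      rw [Finset.piecewise_insert, Finset.card_insert_of_notMem hj]
      have h1 := hf (s.piecewise y x) j (y j)
      have h2 := abs_sub_le (f x) (f (s.piecewise y x))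
        (f (Function.update (s.piecewise y x) j (y j)))
      push_cast
      linarith
  simpa using key Finset.univ

theorem sum_sub_mul_le_of_sub_le {α : Type*} [Fintype α] [Nonempty α] {p q h : α → ℝ} {b L : ℝ}
    (hp : ∀ z, 0 ≤ p z) (hp1 : ∑ z, p z = 1) (hq1 : ∑ z, q z = 1) (hb : 0 ≤ b)
    (hpq : ∀ z, p z - q z ≤ b * p z) (hh : ∀ z w, |h z - h w| ≤ L) :
    ∑ z, (p z - q z) * h z ≤ b * L := by
  obtain ⟨m, hm⟩ := Finite.exists_min h
  calc ∑ z, (p z - q z) * h z = ∑ z, (p z - q z) * (h z - h m) := by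
        simp only [mul_sub _ _ (h m), Finset.sum_sub_distrib, ← Finset.sum_mul, hp1, hq1]
        ring
    _ ≤ ∑ z, b * L * p z := by
        refine Finset.sum_le_sum fun z _ => ?_
        have h0 : 0 ≤ h z - h m := sub_nonneg.2 (hm z)
        calc (p z - q z) * (h z - h m) ≤ b * p z * (h z - h m) :=
              mul_le_mul_of_nonneg_right (hpq z) h0
          _ ≤ b * p z * L :=
              mul_le_mul_of_nonneg_left ((le_abs_self _).trans (hh z m)) (mul_nonneg hb (hp z))
          _ = b * L * p z := by ring
    _ = b * L := by rw [← Finset.mul_sum, hp1, mul_one]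

theorem abs_sum_sub_mul_le_of_sub_le {α : Type*} [Fintype α] [Nonempty α] {p q h : α → ℝ}
    {b L : ℝ} (hp : ∀ z, 0 ≤ p z) (hp1 : ∑ z, p z = 1) (hq1 : ∑ z, q z = 1) (hb : 0 ≤ b)
    (hpq : ∀ z, p z - q z ≤ b * p z) (hh : ∀ z w, |h z - h w| ≤ L) :
    |∑ z, (p z - q z) * h z| ≤ b * L := by
  rw [abs_le']
  refine ⟨sum_sub_mul_le_of_sub_le hp hp1 hq1 hb hpq hh, ?_⟩
  have := sum_sub_mul_le_of_sub_le (h := fun z => -h z) hp hp1 hq1 hb hpq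
    (fun z w => by rw [neg_sub_neg]; exact hh w z)
  simpa only [mul_neg, Finset.sum_neg_distrib] using this

theorem exp_div_sub_exp_div_le {a a' A A' b : ℝ} (hA' : 0 < A') (hAA' : A' ≤ A)
    (h : |a - a'| ≤ b) :
    Real.exp a / A - Real.exp a' / A' ≤ b * (Real.exp a / A) := by
  have hA : 0 < A := hA'.trans_le hAA'
  have h1 : (1 - b) * Real.exp a ≤ Real.exp a' := by
    have h2 : a' = (a' - a) + a := by ring
    rw [h2, Real.exp_add]
    refine mul_le_mul_of_nonneg_right ?_ (Real.exp_pos a).le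
    have := Real.add_one_le_exp (a' - a)
    have := (abs_le.1 h).2
    linarith
  have h3 : (1 - b) * (Real.exp a / A) ≤ Real.exp a' / A' :=
    calc (1 - b) * (Real.exp a / A) = (1 - b) * Real.exp a / A := by ring
      _ ≤ Real.exp a' / A := by gcongr
      _ ≤ Real.exp a' / A' := by gcongr
  linarith

/-- Gibbs distributions on a finite type whose exponents differ by at most `b` are close. -/
theorem abs_sum_gibbs_sub_mul_le {α : Type*} [Fintype α] [Nonempty α] {a a' h : α → ℝ} {b L : ℝ}
    (hb : 0 ≤ b) (haa' : ∀ z, |a z - a' z| ≤ b) (hh : ∀ z w, |h z - h w| ≤ L) :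
    |∑ z, (Real.exp (a z) / ∑ w, Real.exp (a w) -
      Real.exp (a' z) / ∑ w, Real.exp (a' w)) * h z| ≤ b * L := by
  have hpos : ∀ a : α → ℝ, 0 < ∑ w, Real.exp (a w) := fun a =>
    Finset.sum_pos (fun w _ => Real.exp_pos _) Finset.univ_nonempty
  have hone : ∀ a : α → ℝ, ∑ z, Real.exp (a z) / ∑ w, Real.exp (a w) = 1 := fun a => by
    rw [← Finset.sum_div, div_self (hpos a).ne']
  rcases le_total (∑ w, Real.exp (a' w)) (∑ w, Real.exp (a w)) with hle | hle
  · exact abs_sum_sub_mul_le_of_sub_le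
      (fun z => div_nonneg (Real.exp_pos _).le (hpos a).le) (hone a) (hone a') hb
      (fun z => exp_div_sub_exp_div_le (hpos a') hle (haa' z)) hh
  · rw [← abs_neg, ← Finset.sum_neg_distrib]
    simp only [← neg_mul, neg_sub]
    exact abs_sum_sub_mul_le_of_sub_le
      (fun z => div_nonneg (Real.exp_pos _).le (hpos a').le) (hone a') (hone a) hb
      (fun z => exp_div_sub_exp_div_le (hpos a) hle (by rw [abs_sub_comm]; exact haa' z)) hh

/-- One step of the logit dynamics contracts the variation under single-coordinate updates. -/
theorem abs_logitP_mulVec_sub_update_le {u : Fin n → (∀ i, S i) → ℝ} {Φ : (∀ i, S i) → ℝ}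
    (hpot : IsPotential u Φ) {c β : ℝ} (hloc : 0 < localVar Φ) (hβ0 : 0 ≤ β) (hc0 : 0 ≤ c)
    (hβ : β ≤ c / ((n : ℝ) * localVar Φ)) {f : (∀ i, S i) → ℝ} {L : ℝ}
    (hf : ∀ x i a, |f x - f (Function.update x i a)| ≤ L) (x : ∀ i, S i) (j : Fin n) (a : S j) :
    |(logitP β u).mulVec f x - (logitP β u).mulVec f (Function.update x j a)| ≤
      (1 - (1 - c) / n) * L := by
  have hn0 : (0 : ℝ) < n := Nat.cast_pos.2 j.pos
  have hn1 : (1 : ℝ) ≤ n := Nat.one_le_cast.2 j.pos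
  have hL : 0 ≤ L := (abs_nonneg _).trans (hf x j a)
  have hb : β * localVar Φ ≤ c / n := by
    calc β * localVar Φ ≤ c / ((n : ℝ) * localVar Φ) * localVar Φ := by gcongr
      _ = c / n := by field_simp
  set y := Function.update x j a with hy
  set D : Fin n → ℝ := fun i => ∑ z, logitSigma β u i z x * f (Function.update x i z) -
    ∑ z, logitSigma β u i z y * f (Function.update y i z) with hD
  have hDj : D j = 0 := by
    simp [hD, hy, logitSigma_update_self]
  have hDi : ∀ i, i ≠ j → |D i| ≤ (1 + c / n) * L := by
    intro i hij
    have hcomm : ∀ z, Function.update y i z = Function.update (Function.update x i z) j a :=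
      fun z => by rw [hy, Function.update_comm hij.symm]
    have hsplit : D i =
        ∑ z, logitSigma β u i z x * (f (Function.update x i z) - f (Function.update y i z)) +
        ∑ z, (logitSigma β u i z x - logitSigma β u i z y) * f (Function.update y i z) := by
      simp only [hD, mul_sub, sub_mul, Finset.sum_sub_distrib]
      ring
    have h1 : |∑ z, logitSigma β u i z x *
        (f (Function.update x i z) - f (Function.update y i z))| ≤ L := by
      calc _ ≤ ∑ z, |logitSigma β u i z x *
            (f (Function.update x i z) - f (Function.update y i z))| :=
            Finset.abs_sum_le_sum_abs _ _
        _ ≤ ∑ z, logitSigma β u i z x * L := by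
            refine Finset.sum_le_sum fun z _ => ?_
            rw [abs_mul, abs_of_nonneg (logitSigma_nonneg β u i z x), hcomm]
            exact mul_le_mul_of_nonneg_left (hf _ _ _) (logitSigma_nonneg β u i z x)
        _ = L := by rw [← Finset.sum_mul, sum_logitSigma, one_mul]
    have h2 : |∑ z, (logitSigma β u i z x - logitSigma β u i z y) *
        f (Function.update y i z)| ≤ c / n * L := by
      simp only [logitSigma_eq_of_isPotential hpot]
      refine abs_sum_gibbs_sub_mul_le (by positivity) (fun z => ?_) (fun z w => ?_)
      · rw [← mul_sub, abs_mul, abs_neg, abs_of_nonneg hβ0, hcomm]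
        exact (mul_le_mul_of_nonneg_left
          (abs_sub_update_le_localVar hloc.le _ _ _) hβ0).trans hb
      · simpa using hf (Function.update y i z) i w
    rw [hsplit]
    calc _ ≤ _ := abs_add_le _ _
      _ ≤ L + c / n * L := add_le_add h1 h2
      _ = (1 + c / n) * L := by ring
  have hsum : |∑ i, D i| ≤ (n - 1) * ((1 + c / n) * L) := by
    rw [← Finset.add_sum_erase _ _ (Finset.mem_univ j), hDj, zero_add]
    calc |∑ i ∈ Finset.univ.erase j, D i| ≤ ∑ i ∈ Finset.univ.erase j, |D i| :=
          Finset.abs_sum_le_sum_abs _ _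
      _ ≤ (Finset.univ.erase j).card • ((1 + c / n) * L) :=
          Finset.sum_le_card_nsmul _ _ _ fun i hi => hDi i (Finset.ne_of_mem_erase hi)
      _ = (n - 1) * ((1 + c / n) * L) := by
          rw [Finset.card_erase_of_mem (Finset.mem_univ j), Finset.card_univ, Fintype.card_fin,
            nsmul_eq_mul, Nat.cast_sub j.pos, Nat.cast_one]
  rw [logitP_mulVec, logitP_mulVec, ← mul_sub, ← Finset.sum_sub_distrib, abs_mul,
    abs_of_nonneg (by positivity)]
  calc 1 / (n : ℝ) * |∑ i, D i| ≤ 1 / n * ((n - 1) * ((1 + c / n) * L)) := by gcongr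
    _ = (1 - (1 - c) / n) * L - c / n ^ 2 * L := by field_simp; ring
    _ ≤ (1 - (1 - c) / n) * L := sub_le_self _ (by positivity)

theorem abs_logitP_pow_mulVec_sub_update_le {u : Fin n → (∀ i, S i) → ℝ} {Φ : (∀ i, S i) → ℝ}
    (hpot : IsPotential u Φ) {c β : ℝ} (hloc : 0 < localVar Φ) (hβ0 : 0 ≤ β) (hc0 : 0 ≤ c)
    (hβ : β ≤ c / ((n : ℝ) * localVar Φ)) {f : (∀ i, S i) → ℝ} {L : ℝ}
    (hf : ∀ x i a, |f x - f (Function.update x i a)| ≤ L) (t : ℕ) (x : ∀ i, S i) (j : Fin n)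
    (a : S j) :
    |(logitP β u ^ t).mulVec f x - (logitP β u ^ t).mulVec f (Function.update x j a)| ≤
      (1 - (1 - c) / n) ^ t * L := by
  induction t generalizing x j a with
  | zero => simpa using hf x j a
  | succ t ih =>
    rw [pow_succ', ← Matrix.mulVec_mulVec, pow_succ', mul_assoc]
    exact abs_logitP_mulVec_sub_update_le hpot hloc hβ0 hc0 hβ ih x j a

theorem natCast_mul_pow_le_of_log_le (hn : 1 ≤ n) {c ε : ℝ} (hc0 : 0 < c) (hc1 : c < 1)
    (hε : 0 < ε) {t : ℕ}
    (ht : ((n : ℝ) / (1 - c)) * (Real.log (n : ℝ) + Real.log (1 / ε)) ≤ (t : ℝ)) :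
    n * (1 - (1 - c) / n) ^ t ≤ ε := by
  have hn1 : (1 : ℝ) ≤ n := Nat.one_le_cast.2 hn
  have hn0 : (0 : ℝ) < n := by linarith
  have hc : 0 < 1 - c := by linarith
  have hα0 : 0 ≤ 1 - (1 - c) / n := by
    rw [sub_nonneg, div_le_one hn0]
    linarith
  have hα : 1 - (1 - c) / n ≤ Real.exp (-((1 - c) / n)) := Real.one_sub_le_exp_neg _
  have hlog : Real.log n + Real.log (1 / ε) ≤ t * ((1 - c) / n) := by
    calc Real.log n + Real.log (1 / ε)
        = n / (1 - c) * (Real.log n + Real.log (1 / ε)) * ((1 - c) / n) := by field_simp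
      _ ≤ t * ((1 - c) / n) := by gcongr
  calc n * (1 - (1 - c) / n) ^ t ≤ n * Real.exp (-((1 - c) / n)) ^ t := by gcongr
    _ = n * Real.exp (-(t * ((1 - c) / n))) := by rw [← Real.exp_nat_mul, mul_neg]
    _ ≤ n * Real.exp (-(Real.log n + Real.log (1 / ε))) := by gcongr
    _ = ε := by
      rw [← Real.log_mul hn0.ne' (by positivity), Real.exp_neg, Real.exp_log (by positivity)]
      field_simp

/-- For an `n`-player potential game with maximum local variation
`δΦ > 0` and `β ≤ c/(n·δΦ)` with `0 < c < 1`, after `t ≥ (n/(1−c))·(ln n + ln(1/ε))`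
steps the logit dynamics is within total variation distance `ε` of the Gibbs measure,
from every starting profile; in particular the mixing time is `O(n log n)`. -/
theorem logit_mixing_small_beta
    (hn : 1 ≤ n) (u : Fin n → (∀ i, S i) → ℝ) (Φ : (∀ i, S i) → ℝ)
    (hpot : IsPotential u Φ) (c β : ℝ) (hc0 : 0 < c) (hc1 : c < 1)
    (hloc : 0 < localVar Φ) (hβ0 : 0 ≤ β) (hβ : β ≤ c / ((n : ℝ) * localVar Φ)) :
    ∀ ε : ℝ, 0 < ε → ε < 1 → ∀ t : ℕ,
      ((n : ℝ) / (1 - c)) * (Real.log (n : ℝ) + Real.log (1 / ε)) ≤ (t : ℝ) →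
      ∀ x : ∀ i, S i, tvDist ((logitP β u ^ t) x) (gibbs β Φ) ≤ ε := by
  intro ε hε _ t ht x
  set μ := (logitP β u ^ t) x with hμ
  set f : (∀ i, S i) → ℝ := fun z => if gibbs β Φ z ≤ μ z then 1 / 2 else -(1 / 2) with hf
  have hfL : ∀ y i a, |f y - f (Function.update y i a)| ≤ 1 := by
    intro y i a
    simp only [hf]
    split_ifs <;> norm_num
  have htv : tvDist μ (gibbs β Φ) = ∑ z, (μ z - gibbs β Φ z) * f z := by
    rw [tvDist, Finset.mul_sum]
    refine Finset.sum_congr rfl fun z _ => ?_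
    simp only [hf]
    split_ifs with h
    · rw [abs_of_nonneg (sub_nonneg.2 h)]
      ring
    · rw [abs_of_neg (sub_neg.2 (not_le.1 h))]
      ring
  set g := (logitP β u ^ t).mulVec f with hg
  have hgx : ∑ z, μ z * f z = g x := rfl
  have hπg : ∑ z, gibbs β Φ z * f z = ∑ y, gibbs β Φ y * g y := by
    have h := Matrix.dotProduct_mulVec (gibbs β Φ) (logitP β u ^ t) f
    rw [gibbs_vecMul_logitP_pow hn hpot] at h
    exact h.symm
  have hgL := abs_sub_le_of_abs_sub_update_le
    (abs_logitP_pow_mulVec_sub_update_le hpot hloc hβ0 hc0.le hβ hfL t) x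
  calc tvDist μ (gibbs β Φ) = g x - ∑ y, gibbs β Φ y * g y := by
        simp only [htv, sub_mul, Finset.sum_sub_distrib, hgx, hπg]
    _ = ∑ y, gibbs β Φ y * (g x - g y) := by
        simp only [mul_sub, Finset.sum_sub_distrib, ← Finset.sum_mul, sum_gibbs, one_mul]
    _ ≤ ∑ y, gibbs β Φ y * ε := by
        refine Finset.sum_le_sum fun y _ => mul_le_mul_of_nonneg_left ?_ (gibbs_nonneg β Φ y)
        refine (le_abs_self _).trans ((hgL y).trans ?_)
        rw [mul_one]
        exact natCast_mul_pow_le_of_log_le hn hc0 hc1 hε ht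
    _ = ε := by rw [← Finset.sum_mul, sum_gibbs, one_mul]
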